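/- Exponential moment condition (well-posedness for Varadhan's lemma): For every γ ∈ (1, α), one has limsup_{n→∞} (1/n) ln E_y[ exp( γ n [ −(1/2) ln((1/m) Σ_μ φ'(y_μ)²) + κ_{α,φ}(ν_y^m, t_φ(ν_y^m)) ] ) ] < +∞ and limsup_{n→∞} (1/n) ln E_y[ exp( γ n [ −(1/2) ln((1/m) Σ_μ φ'(y_μ)²) + (1/n) ln E_z[|det H_n^Λ(y)|] ] ) ] < +∞, where y ~ N(0, I_m). -/

import Mathlib

/- STATEMENT 6: exponential moment condition making Varadhan's lemma applicable
(Lemma 2.6 of the paper): for every γ ∈ (1,α),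
 limsup_n (1/n) ln E_y[ exp(γ n [−(1/2) ln((1/m)∑φ'(y_μ)²) + κ_{α,φ}(ν_y^m,t_φ(ν_y^m))]) ] < ∞
and
 limsup_n (1/n) ln E_y[ exp(γ n [−(1/2) ln((1/m)∑φ'(y_μ)²) + (1/n) ln E_z|det H_n^Λ(y)|]) ] < ∞.
`limsup (1/n) ln E < ∞` is rendered as: there exists M with E ≤ exp(nM) eventually. -/


open MeasureTheory Matrix Filter Topology Real Set ProbabilityTheory
open scoped ENNReal NNReal Classical

noncomputable section

abbrev stdGauss : Measure ℝ := gaussianReal 0 1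

def gaussVec (k : ℕ) : Measure (Fin k → ℝ) := Measure.pi fun _ => stdGauss

def gaussMat (a b : ℕ) : Measure (Fin a → Fin b → ℝ) :=
  Measure.pi fun _ => Measure.pi fun _ => stdGauss

def Pperp (φ : ℝ → ℝ) {m : ℕ} (y : Fin m → ℝ) : Matrix (Fin m) (Fin m) ℝ :=
  1 - Matrix.of (fun μ ν => deriv φ (y μ) * deriv φ (y ν) / ∑ ρ, (deriv φ (y ρ)) ^ 2)

def Dmat (φ : ℝ → ℝ) (n : ℕ) {m : ℕ} (y : Fin m → ℝ) : Matrix (Fin m) (Fin m) ℝ :=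
  Matrix.diagonal fun μ => ((n : ℝ) / m) * deriv (deriv φ) (y μ)

def Lam (φ : ℝ → ℝ) (n : ℕ) {m : ℕ} (y : Fin m → ℝ) : Matrix (Fin m) (Fin m) ℝ :=
  Pperp φ y * Dmat φ n y * Pperp φ y

def Hmat (φ : ℝ → ℝ) (n : ℕ) {m : ℕ} (y : Fin m → ℝ)
    (z : Fin (n - 1) → Fin m → ℝ) : Matrix (Fin (n - 1)) (Fin (n - 1)) ℝ :=
  ((n : ℝ)⁻¹) • (Matrix.of z * Lam φ n y * (Matrix.of z)ᵀ) -
    ((1 / (m : ℝ)) * ∑ μ, y μ * deriv φ (y μ)) • 1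

/-- `E_z |det H_n^Λ(y)|`. -/
def Edet (φ : ℝ → ℝ) (n m : ℕ) (y : Fin m → ℝ) : ℝ :=
  ∫ z, |Matrix.det (Hmat φ n y z)| ∂(gaussMat (n - 1) m)

/-- Eigenvalues of a (Hermitian) real matrix; junk value `0` otherwise. -/
def eigs {k : ℕ} (M : Matrix (Fin k) (Fin k) ℝ) : Fin k → ℝ :=
  if h : M.IsHermitian then h.eigenvalues else 0

/-- Empirical measure `ν_y^m = (1/m) ∑_μ δ_{y_μ}`. -/
def empMeas {m : ℕ} (y : Fin m → ℝ) : Measure ℝ :=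
  (m : ℝ≥0∞)⁻¹ • ∑ μ : Fin m, Measure.dirac (y μ)

/-- `t_φ(ν) = ∫ x φ'(x) ν(dx)`. -/
def tphi (φ : ℝ → ℝ) (ν : Measure ℝ) : ℝ := ∫ x, x * deriv φ x ∂ν

/-- `μAF ν` has the Stieltjes transform of the asymptotic spectral measure
`μ_{α,φ}[ν]` of `z D^{(ν)} zᵀ/m`. -/
def IsAsymptoticSpectralMeasure (φ : ℝ → ℝ) (α : ℝ) (μAF : Measure ℝ → Measure ℝ) :
    Prop :=
  ∀ ν : Measure ℝ, IsProbabilityMeasure ν →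
    IsProbabilityMeasure (μAF ν) ∧
    ∀ z : ℂ, 0 < z.im →
      (∫ x, ((x : ℂ) - z)⁻¹ ∂(μAF ν)) =
        -(z - (α : ℂ) * ∫ t, ((deriv (deriv φ) t : ℝ) : ℂ) /
            ((α : ℂ) + ((deriv (deriv φ) t : ℝ) : ℂ) * ∫ x, ((x : ℂ) - z)⁻¹ ∂(μAF ν))
          ∂ν)⁻¹

/-- `κ_{α,φ}(ν,C) = ∫ ln|x−C| μ_{α,φ}[ν](dx)`. -/
def kappa (μAF : Measure ℝ → Measure ℝ) (ν : Measure ℝ) (C : ℝ) : ℝ :=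
  ∫ x, Real.log |x - C| ∂(μAF ν)


theorem integral_im_resolvent (μ : Measure ℝ) [IsProbabilityMeasure μ] {η : ℝ} (hη : 0 < η) :
    ∫ x : ℝ, x ^ 2 / (x ^ 2 + η ^ 2) ∂μ =
      1 - η * (∫ x : ℝ, ((x : ℂ) - η * Complex.I)⁻¹ ∂μ).im := by
  have him : ∀ x : ℝ, (((x : ℂ) - η * Complex.I)⁻¹).im = η / (x ^ 2 + η ^ 2) := by
    intro x
    simp [Complex.inv_im, Complex.normSq_apply]
    ring
  have hint : Integrable (fun x : ℝ => ((x : ℂ) - η * Complex.I)⁻¹) μ := by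
    refine Integrable.of_bound (C := η⁻¹) (by fun_prop) (ae_of_all _ fun x => ?_)
    rw [norm_inv]
    gcongr
    refine le_trans ?_ (Complex.abs_im_le_norm _)
    simp [abs_of_pos hη]
  have h := integral_im hint
  simp only [RCLike.im_to_complex, him] at h
  rw [← h, ← integral_const_mul]
  have h1 : Integrable (fun x : ℝ => η / (x ^ 2 + η ^ 2)) μ := by
    simpa only [RCLike.im_to_complex, him] using hint.im
  have h2 : (1 : ℝ) = ∫ x : ℝ, 1 ∂μ := by simp
  rw [h2, ← integral_sub (integrable_const _) (h1.const_mul η)]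
  refine integral_congr_ae (ae_of_all _ fun x => ?_)
  have : x ^ 2 + η ^ 2 ≠ 0 := by positivity
  field_simp
  ring

theorem norm_integral_resolvent_le (μ : Measure ℝ) [IsProbabilityMeasure μ] {η : ℝ} (hη : 0 < η) :
    ‖∫ x : ℝ, ((x : ℂ) - η * Complex.I)⁻¹ ∂μ‖ ≤ η⁻¹ := by
  have := norm_integral_le_of_norm_le_const (μ := μ) (C := η⁻¹)
    (f := fun x : ℝ => ((x : ℂ) - η * Complex.I)⁻¹) (ae_of_all _ fun x => by
      rw [norm_inv]
      gcongr
      refine le_trans ?_ (Complex.abs_im_le_norm _)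
      simp [abs_of_pos hη])
  simpa using this

theorem abs_im_integral_le {X : Type*} [MeasurableSpace X] (ν : Measure X)
    [IsProbabilityMeasure ν] {f : X → ℂ} {c : ℝ} (hc : 0 ≤ c) (h : ∀ x, |(f x).im| ≤ c) :
    |(∫ x, f x ∂ν).im| ≤ c := by
  by_cases hf : Integrable f ν
  · have h1 := integral_im hf
    simp only [RCLike.im_to_complex] at h1
    rw [← h1, ← Real.norm_eq_abs]
    simpa using norm_integral_le_of_norm_le_const (μ := ν) (C := c)
      (f := fun x => (f x).im) (ae_of_all _ h)
  · simpa [integral_undef hf] using hc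

theorem norm_add_mul_ge {α K η d : ℝ} {s : ℂ} (hα : 1 < α) (hd : |d| ≤ K) (hη : 1 ≤ η)
    (hηK : 4 * K ≤ η) (hs : ‖s‖ ≤ η⁻¹) : α / 2 ≤ ‖(α : ℂ) + d * s‖ := by
  have h1 : ‖(d : ℂ) * s‖ ≤ 1 / 4 := by
    rw [norm_mul, Complex.norm_real, Real.norm_eq_abs]
    have hK : 0 ≤ K := (abs_nonneg d).trans hd
    calc |d| * ‖s‖ ≤ K * η⁻¹ := by gcongr
      _ ≤ (η / 4) * η⁻¹ := by gcongr; linarith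
      _ = 1 / 4 := by field_simp
  have h2 := norm_sub_norm_le (α : ℂ) (-((d : ℂ) * s))
  rw [sub_neg_eq_add, norm_neg, Complex.norm_real, Real.norm_eq_abs, abs_of_pos (by linarith)] at h2
  linarith

theorem integral_truncated_sq_le {φ : ℝ → ℝ} {α K : ℝ} (hα : 1 < α)
    (hK : ∀ x, |deriv (deriv φ) x| ≤ K) {μAF : Measure ℝ → Measure ℝ}
    (hμAF : IsAsymptoticSpectralMeasure φ α μAF) (ν : Measure ℝ) [IsProbabilityMeasure ν]
    {η : ℝ} (hη : 1 ≤ η) (hηK : 4 * K ≤ η) :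
    ∫ x : ℝ, x ^ 2 / (x ^ 2 + η ^ 2) ∂(μAF ν) ≤ 32 * K ^ 2 / η ^ 2 := by
  obtain ⟨hprob, hst⟩ := hμAF ν inferInstance
  have hη0 : 0 < η := by linarith
  have hK0 : 0 ≤ K := (abs_nonneg _).trans (hK 0)
  rw [integral_im_resolvent _ hη0]
  have hs := norm_integral_resolvent_le (μAF ν) hη0
  have hS := hst (η * Complex.I) (by simpa using hη0)
  set s := ∫ x : ℝ, ((x : ℂ) - η * Complex.I)⁻¹ ∂(μAF ν)
  set w := ∫ t, ((deriv (deriv φ) t : ℝ) : ℂ) /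
            ((α : ℂ) + ((deriv (deriv φ) t : ℝ) : ℂ) * s) ∂ν with hw
  have hden := fun t => norm_add_mul_ge hα (hK t) hη hηK hs
  have hα0 : 0 < α := by linarith
  have hwn : ‖w‖ ≤ K / (α / 2) := by
    have := norm_integral_le_of_norm_le_const (μ := ν) (C := K / (α / 2))
      (f := fun t => ((deriv (deriv φ) t : ℝ) : ℂ) /
            ((α : ℂ) + ((deriv (deriv φ) t : ℝ) : ℂ) * s)) (ae_of_all _ fun t => by
        rw [norm_div, Complex.norm_real, Real.norm_eq_abs]
        exact div_le_div₀ hK0 (hK t) (by positivity) (hden t))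
    simpa using this
  have hwi : |w.im| ≤ K ^ 2 * η⁻¹ / (α * (α / 2)) := by
    refine abs_im_integral_le ν (by positivity) fun t => ?_
    set d := deriv (deriv φ) t
    have hne : (α : ℂ) + (d : ℂ) * s ≠ 0 := by
      rw [← norm_pos_iff]; exact lt_of_lt_of_le (by positivity) (hden t)
    have hαc : (α : ℂ) ≠ 0 := by exact_mod_cast hα0.ne'
    have heq : (d : ℂ) / (α + d * s) = ((d / α : ℝ) : ℂ) - d ^ 2 * s / (α * (α + d * s)) := by
      push_cast
      field_simp
      ring
    have him : ((d : ℂ) / (α + d * s)).im = -(d ^ 2 * s / (α * (α + d * s))).im := by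
      rw [heq, Complex.sub_im, Complex.ofReal_im, zero_sub]
    rw [him, abs_neg]
    refine (Complex.abs_im_le_norm _).trans ?_
    rw [norm_div, norm_mul, norm_mul, norm_pow, Complex.norm_real, Complex.norm_real,
      Real.norm_eq_abs, Real.norm_eq_abs, abs_of_pos hα0]
    have := hden t
    have := hK t
    gcongr
  have hA : |α * w.re| ≤ 2 * K := by
    rw [abs_mul, abs_of_pos hα0]
    calc α * |w.re| ≤ α * (K / (α / 2)) := by gcongr; exact (Complex.abs_re_le_norm _).trans hwn
      _ = 2 * K := by field_simp
  have hB : |α * w.im| ≤ 2 * K := by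
    rw [abs_mul, abs_of_pos hα0]
    calc α * |w.im| ≤ α * (K / (α / 2)) := by gcongr; exact (Complex.abs_im_le_norm _).trans hwn
      _ = 2 * K := by field_simp
  have hB' : |α * w.im| * η ≤ 2 * K ^ 2 := by
    rw [abs_mul, abs_of_pos hα0]
    calc α * |w.im| * η ≤ α * (K ^ 2 * η⁻¹ / (α * (α / 2))) * η := by gcongr
      _ = 2 * K ^ 2 / α := by field_simp
      _ ≤ 2 * K ^ 2 := div_le_self (by positivity) hα.le
  have him : s.im = (η - α * w.im) / ((α * w.re) ^ 2 + (η - α * w.im) ^ 2) := by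
    rw [hS]
    simp [Complex.inv_im, Complex.normSq_apply]
    ring
  rw [him]
  generalize α * w.re = a at *
  generalize α * w.im = b at *
  have hb := abs_le.1 hB
  have hgap : η / 2 ≤ η - b := by linarith
  have hpos : 0 < a ^ 2 + (η - b) ^ 2 := by nlinarith
  have heq : 1 - η * ((η - b) / (a ^ 2 + (η - b) ^ 2))
      = (a ^ 2 - b * (η - b)) / (a ^ 2 + (η - b) ^ 2) := by
    field_simp
    ring
  rw [heq]
  have hnum : a ^ 2 - b * (η - b) ≤ 8 * K ^ 2 := by
    have h1 : a ^ 2 ≤ (2 * K) ^ 2 := sq_le_sq' (abs_le.1 hA).1 (abs_le.1 hA).2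
    have h2 : -b * (η - b) ≤ |b| * (2 * η) := by
      exact mul_le_mul (neg_le_abs b) (by linarith) (by linarith) (abs_nonneg b)
    nlinarith
  calc (a ^ 2 - b * (η - b)) / (a ^ 2 + (η - b) ^ 2)
      ≤ 8 * K ^ 2 / (η / 2) ^ 2 := by
        refine div_le_div₀ (by positivity) hnum (by positivity) ?_
        nlinarith [sq_nonneg a]
    _ = 32 * K ^ 2 / η ^ 2 := by field_simp; ring

theorem lintegral_sq_asymptoticSpectralMeasure_le {φ : ℝ → ℝ} {α K : ℝ} (hα : 1 < α)
    (hK : ∀ x, |deriv (deriv φ) x| ≤ K) {μAF : Measure ℝ → Measure ℝ}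
    (hμAF : IsAsymptoticSpectralMeasure φ α μAF) (ν : Measure ℝ) [IsProbabilityMeasure ν] :
    ∫⁻ x : ℝ, ENNReal.ofReal (x ^ 2) ∂(μAF ν) ≤ ENNReal.ofReal (32 * K ^ 2) := by
  have hprob := (hμAF ν inferInstance).1
  have hlim : ∀ x : ℝ, Tendsto (fun k : ℕ => ENNReal.ofReal
      ((k : ℝ) ^ 2 * (x ^ 2 / (x ^ 2 + (k : ℝ) ^ 2)))) atTop (𝓝 (ENNReal.ofReal (x ^ 2))) := by
    intro x
    refine ENNReal.tendsto_ofReal ?_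
    have h1 : Tendsto (fun k : ℕ => x ^ 2 * (1 / (x ^ 2 / (k : ℝ) ^ 2 + 1))) atTop
        (𝓝 (x ^ 2 * (1 / (0 + 1)))) := by
      refine Tendsto.const_mul _ (Tendsto.div tendsto_const_nhds (Tendsto.add_const _ ?_) (by simp))
      exact tendsto_const_nhds.div_atTop
        ((tendsto_pow_atTop two_ne_zero).comp tendsto_natCast_atTop_atTop)
    have h2 : x ^ 2 * (1 / (0 + 1)) = x ^ 2 := by ring
    rw [h2] at h1
    refine h1.congr' ?_
    filter_upwards [eventually_gt_atTop 0] with k hk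
    have : (0 : ℝ) < k := by exact_mod_cast hk
    field_simp
  calc ∫⁻ x : ℝ, ENNReal.ofReal (x ^ 2) ∂(μAF ν)
      = ∫⁻ x : ℝ, liminf (fun k : ℕ => ENNReal.ofReal
          ((k : ℝ) ^ 2 * (x ^ 2 / (x ^ 2 + (k : ℝ) ^ 2)))) atTop ∂(μAF ν) :=
        lintegral_congr fun x => (hlim x).liminf_eq.symm
    _ ≤ liminf (fun k : ℕ => ∫⁻ x : ℝ, ENNReal.ofReal
          ((k : ℝ) ^ 2 * (x ^ 2 / (x ^ 2 + (k : ℝ) ^ 2))) ∂(μAF ν)) atTop :=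
        lintegral_liminf_le fun k => by fun_prop
    _ ≤ ENNReal.ofReal (32 * K ^ 2) := by
        refine liminf_le_of_frequently_le' (Eventually.frequently ?_)
        filter_upwards [eventually_ge_atTop 1, eventually_ge_atTop ⌈4 * K⌉₊] with k hk1 hk2
        have hk : (1 : ℝ) ≤ k := by exact_mod_cast hk1
        have h := integral_truncated_sq_le hα hK hμAF ν hk (Nat.ceil_le.1 hk2)
        rw [← ofReal_integral_eq_lintegral_ofReal]
        · refine ENNReal.ofReal_le_ofReal ?_
          rw [integral_const_mul]
          calc (k : ℝ) ^ 2 * _ ≤ (k : ℝ) ^ 2 * (32 * K ^ 2 / (k : ℝ) ^ 2) := by gcongr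
            _ = 32 * K ^ 2 := by field_simp
        · refine Integrable.const_mul ?_ _
          refine Integrable.of_bound (C := 1)
            (by exact Measurable.aestronglyMeasurable (by fun_prop)) (ae_of_all _ fun x => ?_)
          rw [Real.norm_eq_abs, abs_of_nonneg (by positivity)]
          exact div_le_one_of_le₀ (by nlinarith) (by positivity)
        · exact ae_of_all _ fun x => by positivity

theorem log_abs_le_sq (u : ℝ) : Real.log |u| ≤ u ^ 2 / 2 := by
  rcases eq_or_ne u 0 with rfl | hu
  · simp
  · have h := Real.log_le_sub_one_of_pos (pow_pos (abs_pos.2 hu) 2)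
    rw [Real.log_pow, sq_abs] at h
    push_cast at h
    linarith

theorem kappa_le {φ : ℝ → ℝ} {α K : ℝ} (hα : 1 < α)
    (hK : ∀ x, |deriv (deriv φ) x| ≤ K) {μAF : Measure ℝ → Measure ℝ}
    (hμAF : IsAsymptoticSpectralMeasure φ α μAF) (ν : Measure ℝ) [IsProbabilityMeasure ν] (C : ℝ) :
    kappa μAF ν C ≤ 32 * K ^ 2 + C ^ 2 := by
  have hprob := (hμAF ν inferInstance).1
  have hle := lintegral_sq_asymptoticSpectralMeasure_le hα hK hμAF ν
  have hsq : Integrable (fun x : ℝ => x ^ 2) (μAF ν) := by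
    refine ⟨by fun_prop, ?_⟩
    rw [hasFiniteIntegral_iff_ofReal (ae_of_all _ fun x => by positivity)]
    exact hle.trans_lt ENNReal.ofReal_lt_top
  have hI : ∫ x : ℝ, x ^ 2 ∂(μAF ν) ≤ 32 * K ^ 2 := by
    rw [← ofReal_integral_eq_lintegral_ofReal hsq (ae_of_all _ fun x => by positivity)] at hle
    exact (ENNReal.ofReal_le_ofReal_iff (by positivity)).1 hle
  unfold kappa
  by_cases hf : Integrable (fun x => Real.log |x - C|) (μAF ν)
  · calc ∫ x, Real.log |x - C| ∂(μAF ν) ≤ ∫ x, (x ^ 2 + C ^ 2) ∂(μAF ν) := by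
          refine integral_mono hf (hsq.add (integrable_const _)) fun x => ?_
          have := log_abs_le_sq (x - C)
          dsimp only
          nlinarith [sq_nonneg (x + C)]
      _ = ∫ x, x ^ 2 ∂(μAF ν) + C ^ 2 := by
          rw [integral_add hsq (integrable_const _)]
          simp
      _ ≤ _ := by gcongr
  · rw [integral_undef hf]
    positivity

theorem lintegral_pi_prod {k : ℕ} {X : Type*} [MeasurableSpace X] (μ : Measure X)
    [IsProbabilityMeasure μ] {f : X → ℝ≥0∞} (hf : Measurable f) :
    ∫⁻ x : Fin k → X, ∏ i, f (x i) ∂(Measure.pi fun _ => μ) = (∫⁻ x, f x ∂μ) ^ k := by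
  have h := lintegral_prod_eq_prod_lintegral_of_indepFun (μ := Measure.pi fun _ : Fin k => μ)
    Finset.univ (fun i (x : Fin k → X) => f (x i))
    (iIndepFun_pi (X := fun _ => f) fun _ => hf.aemeasurable)
    (fun i => hf.comp (measurable_pi_apply i))
  rw [h]
  have h2 : ∀ i : Fin k, ∫⁻ x : Fin k → X, f (x i) ∂(Measure.pi fun _ => μ) = ∫⁻ x, f x ∂μ :=
    fun i => (measurePreserving_eval (fun _ : Fin k => μ) i).lintegral_comp hf
  simp [h2]

theorem lintegral_exp_sq_div_four_lt_top :
    ∫⁻ x : ℝ, ENNReal.ofReal (Real.exp (x ^ 2 / 4)) ∂stdGauss < ⊤ := by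
  have hI := ((integrable_exp_neg_mul_sq (b := 1 / 4) (by norm_num)).const_mul
    (√(2 * π * (1 : ℝ≥0)))⁻¹).lintegral_lt_top
  rw [stdGauss, gaussianReal_of_var_ne_zero _ one_ne_zero,
    lintegral_withDensity_eq_lintegral_mul _ (measurable_gaussianPDF _ _) (by fun_prop)]
  refine lt_of_eq_of_lt (lintegral_congr fun x => ?_) hI
  rw [Pi.mul_apply, gaussianPDF, ← ENNReal.ofReal_mul (gaussianPDFReal_nonneg _ _ _),
    gaussianPDFReal, mul_assoc, ← Real.exp_add]
  congr 3
  push_cast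
  ring

theorem exp_mul_sq_le {s : ℝ} (hs : 0 ≤ s) (hs' : s ≤ 1 / 4) (x : ℝ) :
    Real.exp (s * x ^ 2) ≤ 1 + 4 * s * Real.exp (x ^ 2 / 4) := by
  have h := (convexOn_exp).2 (mem_univ (x ^ 2 / 4)) (mem_univ (0 : ℝ)) 
    (by linarith : 0 ≤ 4 * s) (by linarith : 0 ≤ 1 - 4 * s) (by ring)
  simp only [smul_eq_mul, mul_zero, add_zero, Real.exp_zero, mul_one] at h
  have e : 4 * s * (x ^ 2 / 4) = s * x ^ 2 := by ring
  rw [e] at h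
  linarith

theorem exists_lintegral_exp_mul_sq_le : ∃ C : ℝ, 0 ≤ C ∧ ∀ s : ℝ, 0 ≤ s → s ≤ 1 / 4 →
    ∫⁻ x : ℝ, ENNReal.ofReal (Real.exp (s * x ^ 2)) ∂stdGauss ≤ ENNReal.ofReal (Real.exp (C * s)) := by
  set I := ∫⁻ x : ℝ, ENNReal.ofReal (Real.exp (x ^ 2 / 4)) ∂stdGauss with hI
  have hfin : I ≠ ⊤ := lintegral_exp_sq_div_four_lt_top.ne
  refine ⟨4 * I.toReal, by positivity, fun s hs hs' => ?_⟩
  calc ∫⁻ x : ℝ, ENNReal.ofReal (Real.exp (s * x ^ 2)) ∂stdGauss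
      ≤ ∫⁻ x : ℝ, (1 + ENNReal.ofReal (4 * s) * ENNReal.ofReal (Real.exp (x ^ 2 / 4))) ∂stdGauss := by
        refine lintegral_mono fun x => ?_
        rw [← ENNReal.ofReal_mul (by positivity), ← ENNReal.ofReal_one,
          ← ENNReal.ofReal_add zero_le_one (by positivity)]
        exact ENNReal.ofReal_le_ofReal (exp_mul_sq_le hs hs' x)
    _ = 1 + ENNReal.ofReal (4 * s) * I := by
        rw [lintegral_add_left measurable_const, lintegral_const_mul _ (by fun_prop), ← hI]
        simp
    _ = ENNReal.ofReal (1 + 4 * s * I.toReal) := by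
        rw [ENNReal.ofReal_add zero_le_one (by positivity), ENNReal.ofReal_one,
          ENNReal.ofReal_mul (by positivity : 0 ≤ 4 * s), ENNReal.ofReal_toReal hfin]
    _ ≤ ENNReal.ofReal (Real.exp (4 * I.toReal * s)) := by
        refine ENNReal.ofReal_le_ofReal ?_
        have := Real.add_one_le_exp (4 * I.toReal * s)
        linarith

theorem integrableOn_abs_rpow {r : ℝ} (hr : -1 < r) (δ : ℝ) (hδ : 0 < δ) :
    IntegrableOn (fun x : ℝ => |x| ^ r) (Ioc (-δ) δ) := by
  have h1 : IntervalIntegrable (fun x : ℝ => |x| ^ r) volume 0 δ := by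
    refine (intervalIntegral.intervalIntegrable_rpow' hr).congr fun x hx => ?_
    rw [uIoc_of_le hδ.le] at hx
    simp [abs_of_pos hx.1]
  have h2 : IntervalIntegrable (fun x : ℝ => |x| ^ r) volume (-δ) 0 := by
    have := (IntervalIntegrable.iff_comp_neg (f := fun x : ℝ => |x| ^ r)).1 h1
    simpa using this.symm
  exact (intervalIntegrable_iff_integrableOn_Ioc_of_le (by linarith)).1 (h2.trans h1)

theorem lintegral_abs_rpow_lt_top {g : ℝ → ℝ} (hg : Measurable g)
    (hdens : ∃ ε > (0 : ℝ), ∃ f : ℝ → ℝ, ContinuousOn f (Ioo (-ε) ε) ∧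
      ∀ s ⊆ Ioo (-ε) ε, MeasurableSet s →
        Measure.map g stdGauss s = ∫⁻ a in s, ENNReal.ofReal (f a))
    {r : ℝ} (hr : -1 < r) (hr0 : r ≤ 0) :
    ∫⁻ y, ENNReal.ofReal (|g y| ^ r) ∂stdGauss < ⊤ := by
  obtain ⟨ε, hε, f, hf, hs⟩ := hdens
  set δ := ε / 2 with hδ
  have hδ0 : 0 < δ := by positivity
  have hsub : Icc (-δ) δ ⊆ Ioo (-ε) ε := fun x hx => ⟨by linarith [hx.1], by linarith [hx.2]⟩
  obtain ⟨C, hC⟩ := isCompact_Icc.exists_bound_of_continuousOn (hf.mono hsub)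
  have hmeas : Measurable fun a : ℝ => ENNReal.ofReal (|a| ^ r) := by fun_prop
  rw [← lintegral_map (μ := stdGauss) hmeas hg,
    ← lintegral_add_compl _ (measurableSet_Ioc (a := -δ) (b := δ))]
  have : IsProbabilityMeasure (Measure.map g stdGauss) :=
    Measure.isProbabilityMeasure_map hg.aemeasurable
  refine ENNReal.add_lt_top.2 ⟨?_, ?_⟩
  · have hle : (Measure.map g stdGauss).restrict (Ioc (-δ) δ) ≤
        ENNReal.ofReal C • (volume.restrict (Ioc (-δ) δ)) := by
      refine Measure.le_iff.2 fun s hsm => ?_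
      have hm := hsm.inter (measurableSet_Ioc (a := -δ) (b := δ))
      have hsub' : s ∩ Ioc (-δ) δ ⊆ Ioo (-ε) ε :=
        inter_subset_right.trans (Ioc_subset_Icc_self.trans hsub)
      rw [Measure.restrict_apply hsm, hs _ hsub' hm, Measure.smul_apply,
        Measure.restrict_apply hsm, smul_eq_mul, ← setLIntegral_const]
      refine setLIntegral_mono' hm fun x hx => ENNReal.ofReal_le_ofReal ?_
      exact (le_abs_self _).trans (hC x (Ioc_subset_Icc_self hx.2))
    refine (lintegral_mono' hle le_rfl).trans_lt ?_
    rw [lintegral_smul_measure]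
    exact ENNReal.mul_lt_top ENNReal.ofReal_lt_top (integrableOn_abs_rpow hr δ hδ0).lintegral_lt_top
  · calc ∫⁻ a in (Ioc (-δ) δ)ᶜ, ENNReal.ofReal (|a| ^ r) ∂(Measure.map g stdGauss)
        ≤ ∫⁻ a in (Ioc (-δ) δ)ᶜ, ENNReal.ofReal (δ ^ r) ∂(Measure.map g stdGauss) := by
          refine setLIntegral_mono' measurableSet_Ioc.compl fun a ha => ?_
          refine ENNReal.ofReal_le_ofReal (Real.rpow_le_rpow_of_nonpos hδ0 ?_ hr0)
          by_contra! h
          exact ha ⟨(abs_lt.1 h).1, (abs_lt.1 h).2.le⟩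
      _ ≤ ENNReal.ofReal (δ ^ r) * 1 := by
          rw [setLIntegral_const]
          gcongr
          exact prob_le_one
      _ < ⊤ := by simp

theorem ae_ne_zero_of_density {g : ℝ → ℝ} (hg : Measurable g)
    (hdens : ∃ ε > (0 : ℝ), ∃ f : ℝ → ℝ, ContinuousOn f (Ioo (-ε) ε) ∧
      ∀ s ⊆ Ioo (-ε) ε, MeasurableSet s →
        Measure.map g stdGauss s = ∫⁻ a in s, ENNReal.ofReal (f a)) :
    ∀ᵐ y ∂stdGauss, g y ≠ 0 := by
  obtain ⟨ε, hε, f, -, hs⟩ := hdens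
  have h := hs {0} (by simpa using hε) (measurableSet_singleton 0)
  rw [Measure.map_apply hg (measurableSet_singleton 0)] at h
  have h0 : ∫⁻ a in ({0} : Set ℝ), ENNReal.ofReal (f a) = 0 := by simp
  rw [h0] at h
  rw [ae_iff]
  convert h using 2
  ext y
  simp

theorem sum_sq_vecMul_orthonormalBasis {N k : ℕ} (b : OrthonormalBasis (Fin N) ℝ (EuclideanSpace ℝ (Fin N)))
    (z : Matrix (Fin N) (Fin k) ℝ) :
    ∑ i, (zᵀ *ᵥ ⇑(b i)) ⬝ᵥ (zᵀ *ᵥ ⇑(b i)) = ∑ i, ∑ μ, z i μ ^ 2 := by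
  have h : ∀ μ, ∑ i, ((zᵀ *ᵥ ⇑(b i)) μ) ^ 2 = ∑ i, z i μ ^ 2 := by
    intro μ
    have h1 := b.sum_sq_norm_inner_right (WithLp.toLp 2 (fun i => z i μ))
    rw [EuclideanSpace.norm_sq_eq] at h1
    simpa [PiLp.inner_apply, Matrix.mulVec, dotProduct, Matrix.transpose_apply] using h1
  simp only [dotProduct, ← pow_two]
  rw [Finset.sum_comm, Finset.sum_comm (f := fun i μ => z i μ ^ 2)]
  exact Finset.sum_congr rfl fun μ _ => h μ

theorem abs_det_le_exp {N k : ℕ} {H : Matrix (Fin N) (Fin N) ℝ} (hH : H.IsHermitian)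
    (z : Matrix (Fin N) (Fin k) ℝ) (c t : ℝ)
    (h : ∀ v, |v ⬝ᵥ H *ᵥ v| ≤ c * ((zᵀ *ᵥ v) ⬝ᵥ (zᵀ *ᵥ v)) + t * (v ⬝ᵥ v)) :
    |H.det| ≤ Real.exp (t * N + c * ∑ i, ∑ μ, z i μ ^ 2) := by
  have hb : ∀ i, (⇑(hH.eigenvectorBasis i) : Fin N → ℝ) ⬝ᵥ ⇑(hH.eigenvectorBasis i) = 1 := by
    intro i
    have h1 := hH.eigenvectorBasis.norm_eq_one i
    have h2 := EuclideanSpace.norm_sq_eq (hH.eigenvectorBasis i)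
    rw [h1] at h2
    simpa [dotProduct, pow_two] using h2.symm
  have he : ∀ i, |hH.eigenvalues i| ≤
      c * ((zᵀ *ᵥ ⇑(hH.eigenvectorBasis i)) ⬝ᵥ (zᵀ *ᵥ ⇑(hH.eigenvectorBasis i))) + t := by
    intro i
    have h1 := h ⇑(hH.eigenvectorBasis i)
    rw [hb i, mul_one] at h1
    rw [hH.eigenvalues_eq i]
    simpa using h1
  rw [hH.det_eq_prod_eigenvalues]
  simp only [RCLike.ofReal_real_eq_id, id_eq]
  rw [Finset.abs_prod]
  calc ∏ i, |hH.eigenvalues i| ≤ ∏ i, Real.exp (c * ((zᵀ *ᵥ ⇑(hH.eigenvectorBasis i)) ⬝ᵥ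
          (zᵀ *ᵥ ⇑(hH.eigenvectorBasis i))) + t) := by
        refine Finset.prod_le_prod (fun i _ => abs_nonneg _) fun i _ => (he i).trans ?_
        linarith [Real.add_one_le_exp (c * ((zᵀ *ᵥ ⇑(hH.eigenvectorBasis i)) ⬝ᵥ
          (zᵀ *ᵥ ⇑(hH.eigenvectorBasis i))) + t)]
    _ = Real.exp (t * N + c * ∑ i, ∑ μ, z i μ ^ 2) := by
        rw [← Real.exp_sum, Finset.sum_add_distrib, ← Finset.mul_sum,
          sum_sq_vecMul_orthonormalBasis]
        simp
        ring

theorem Pperp_transpose (φ : ℝ → ℝ) {k : ℕ} (y : Fin k → ℝ) : (Pperp φ y)ᵀ = Pperp φ y := by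
  ext i j
  simp [Pperp, Matrix.one_apply, eq_comm, mul_comm]

theorem Pperp_mulVec (φ : ℝ → ℝ) {k : ℕ} (y u : Fin k → ℝ) (i : Fin k) :
    (Pperp φ y *ᵥ u) i = u i - deriv φ (y i) *
      ((∑ j, deriv φ (y j) * u j) / ∑ ρ, (deriv φ (y ρ)) ^ 2) := by
  rw [Pperp, Matrix.sub_mulVec, Matrix.one_mulVec, Pi.sub_apply, Finset.sum_div, Finset.mul_sum]
  simp only [Matrix.mulVec, dotProduct, Matrix.of_apply]
  congr 1
  exact Finset.sum_congr rfl fun j _ => by ring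

theorem Pperp_mulVec_dotProduct_le (φ : ℝ → ℝ) {k : ℕ} (y u : Fin k → ℝ) :
    (Pperp φ y *ᵥ u) ⬝ᵥ (Pperp φ y *ᵥ u) ≤ u ⬝ᵥ u := by
  simp only [dotProduct, Pperp_mulVec]
  set q := ∑ ρ, (deriv φ (y ρ)) ^ 2 with hq
  set p := ∑ j, deriv φ (y j) * u j with hp
  have h : ∑ i, (u i - deriv φ (y i) * (p / q)) * (u i - deriv φ (y i) * (p / q)) =
      ∑ i, u i * u i - 2 * (p / q) * p + (p / q) ^ 2 * q := by
    simp only [hp, hq, Finset.mul_sum, ← Finset.sum_sub_distrib, ← Finset.sum_add_distrib]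
    exact Finset.sum_congr rfl fun j _ => by ring
  rw [h]
  have hq0 : 0 ≤ q := Finset.sum_nonneg fun _ _ => sq_nonneg _
  rcases hq0.eq_or_lt with h0 | h0
  · simp [← h0]
  · have : 2 * (p / q) * p = 2 * ((p / q) ^ 2 * q) := by field_simp
    nlinarith [mul_nonneg (sq_nonneg (p / q)) hq0]

theorem Lam_transpose (φ : ℝ → ℝ) (n : ℕ) {k : ℕ} (y : Fin k → ℝ) :
    (Lam φ n y)ᵀ = Lam φ n y := by
  rw [Lam, Matrix.transpose_mul, Matrix.transpose_mul, Pperp_transpose, Dmat,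
    Matrix.diagonal_transpose, Matrix.mul_assoc]

theorem abs_dotProduct_Lam_le {φ : ℝ → ℝ} {K : ℝ} (hK : ∀ x, |deriv (deriv φ) x| ≤ K) (n : ℕ)
    {k : ℕ} (y u : Fin k → ℝ) :
    |u ⬝ᵥ Lam φ n y *ᵥ u| ≤ n / k * K * (u ⬝ᵥ u) := by
  have hK0 : 0 ≤ K := (abs_nonneg _).trans (hK 0)
  have h1 : u ⬝ᵥ Lam φ n y *ᵥ u = (Pperp φ y *ᵥ u) ⬝ᵥ (Dmat φ n y *ᵥ (Pperp φ y *ᵥ u)) := by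
    rw [Lam, Matrix.mul_assoc, ← Matrix.mulVec_mulVec, ← Matrix.mulVec_mulVec,
      Matrix.dotProduct_mulVec, ← Matrix.mulVec_transpose, Pperp_transpose]
  rw [h1]
  refine le_trans ?_ (mul_le_mul_of_nonneg_left (Pperp_mulVec_dotProduct_le φ y u) (by positivity))
  generalize Pperp φ y *ᵥ u = v
  simp only [dotProduct, Dmat, Matrix.mulVec_diagonal]
  rw [Finset.mul_sum]
  refine (Finset.abs_sum_le_sum_abs _ _).trans (Finset.sum_le_sum fun i _ => ?_)
  have e : v i * ((n : ℝ) / k * deriv (deriv φ) (y i) * v i) =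
      (n : ℝ) / k * deriv (deriv φ) (y i) * (v i * v i) := by ring
  rw [e, abs_mul, abs_mul, abs_of_nonneg (mul_self_nonneg (v i)),
    abs_of_nonneg (by positivity : (0 : ℝ) ≤ (n : ℝ) / k)]
  have := hK (y i)
  have := mul_self_nonneg (v i)
  gcongr

theorem abs_mean_le {K : ℝ} {k : ℕ} {f : Fin k → ℝ} (hK : 0 ≤ K) (h : ∀ i, |f i| ≤ K) :
    |(1 / (k : ℝ)) * ∑ i, f i| ≤ K := by
  rw [abs_mul, abs_of_nonneg (by positivity)]
  have h1 : |∑ i, f i| ≤ k * K := by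
    refine (Finset.abs_sum_le_sum_abs _ _).trans ?_
    simpa using Finset.sum_le_sum fun i (_ : i ∈ Finset.univ) => h i
  rcases k.eq_zero_or_pos with rfl | hk
  · simpa using hK
  · have : (0 : ℝ) < k := by exact_mod_cast hk
    calc 1 / (k : ℝ) * |∑ i, f i| ≤ 1 / (k : ℝ) * (k * K) := by gcongr
      _ = K := by field_simp

theorem abs_det_Hmat_le {φ : ℝ → ℝ} {K : ℝ} (hK : ∀ x, |deriv (deriv φ) x| ≤ K)
    (hK' : ∀ x, |x * deriv φ x| ≤ K) {n k : ℕ} (hn : 0 < n) (y : Fin k → ℝ)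
    (z : Fin (n - 1) → Fin k → ℝ) :
    |(Hmat φ n y z).det| ≤ Real.exp (K * (n - 1 : ℕ) + K / k * ∑ i, ∑ μ, z i μ ^ 2) := by
  have hK0 : 0 ≤ K := (abs_nonneg _).trans (hK 0)
  refine abs_det_le_exp ?_ (Matrix.of z) (K / k) K fun v => ?_
  · rw [Matrix.IsHermitian, Matrix.conjTranspose_eq_transpose_of_trivial, Hmat,
      Matrix.transpose_sub, Matrix.transpose_smul, Matrix.transpose_smul, Matrix.transpose_one,
      Matrix.transpose_mul, Matrix.transpose_mul, Lam_transpose, Matrix.transpose_transpose,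
      Matrix.mul_assoc]
  · have h1 : v ⬝ᵥ Hmat φ n y z *ᵥ v =
        (n : ℝ)⁻¹ * (((Matrix.of z)ᵀ *ᵥ v) ⬝ᵥ Lam φ n y *ᵥ ((Matrix.of z)ᵀ *ᵥ v)) -
          ((1 / (k : ℝ)) * ∑ μ, y μ * deriv φ (y μ)) * (v ⬝ᵥ v) := by
      rw [Hmat, Matrix.sub_mulVec, Matrix.smul_mulVec, Matrix.smul_mulVec, Matrix.one_mulVec,
        dotProduct_sub, dotProduct_smul, dotProduct_smul, smul_eq_mul, smul_eq_mul,
        Matrix.mul_assoc, ← Matrix.mulVec_mulVec, ← Matrix.mulVec_mulVec,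
        Matrix.dotProduct_mulVec v, ← Matrix.mulVec_transpose]
    have hn' : (0 : ℝ) < n := by exact_mod_cast hn
    rw [h1]
    refine (abs_sub _ _).trans (add_le_add ?_ ?_)
    · rw [abs_mul, abs_of_pos (inv_pos.2 hn')]
      refine (mul_le_mul_of_nonneg_left (abs_dotProduct_Lam_le hK n y _) (by positivity)).trans_eq ?_
      field_simp
    · have hv : 0 ≤ v ⬝ᵥ v := Finset.sum_nonneg fun i _ => mul_self_nonneg _
      rw [abs_mul, abs_of_nonneg hv]
      exact mul_le_mul_of_nonneg_right (abs_mean_le hK0 fun i => hK' (y i)) hv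

theorem exists_Edet_le {φ : ℝ → ℝ} {K : ℝ} (hK : ∀ x, |deriv (deriv φ) x| ≤ K)
    (hK' : ∀ x, |x * deriv φ x| ≤ K) : ∃ B : ℝ, 0 ≤ B ∧ ∀ n k : ℕ, 0 < n → 0 < k → 4 * K ≤ k →
      ∀ y : Fin k → ℝ, Edet φ n k y ≤ Real.exp (n * B) := by
  have hK0 : 0 ≤ K := (abs_nonneg _).trans (hK 0)
  obtain ⟨C, hC0, hC⟩ := exists_lintegral_exp_mul_sq_le
  refine ⟨K + C * K, by positivity, fun n k hn hk hkK y => ?_⟩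
  have hk' : (0 : ℝ) < k := by exact_mod_cast hk
  have hs : K / k ≤ 1 / 4 := by rw [div_le_iff₀ hk']; linarith
  have hprod : ∀ z : Fin (n - 1) → Fin k → ℝ,
      ENNReal.ofReal (Real.exp (K * (n - 1 : ℕ) + K / k * ∑ i, ∑ μ, z i μ ^ 2)) =
      ENNReal.ofReal (Real.exp (K * (n - 1 : ℕ))) *
        ∏ i, ∏ μ, ENNReal.ofReal (Real.exp (K / k * z i μ ^ 2)) := by
    intro z
    rw [Real.exp_add, ENNReal.ofReal_mul (Real.exp_nonneg _)]
    simp only [Finset.mul_sum, Real.exp_sum]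
    rw [ENNReal.ofReal_prod_of_nonneg fun i _ => by positivity]
    congr 1
    exact Finset.prod_congr rfl fun i _ => ENNReal.ofReal_prod_of_nonneg fun i _ => by positivity
  have hle : ENNReal.ofReal (Edet φ n k y) ≤ ENNReal.ofReal (Real.exp (n * (K + C * K))) := by
    calc ENNReal.ofReal (Edet φ n k y) ≤ ‖Edet φ n k y‖ₑ := Real.ofReal_le_enorm _
      _ ≤ ∫⁻ z, ‖|(Hmat φ n y z).det|‖ₑ ∂(gaussMat (n - 1) k) :=
          enorm_integral_le_lintegral_enorm _
      _ ≤ ∫⁻ z, ENNReal.ofReal (Real.exp (K * (n - 1 : ℕ))) *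
            ∏ i, ∏ μ, ENNReal.ofReal (Real.exp (K / k * z i μ ^ 2)) ∂(gaussMat (n - 1) k) := by
          refine lintegral_mono fun z => ?_
          rw [← hprod, Real.enorm_eq_ofReal (abs_nonneg _)]
          exact ENNReal.ofReal_le_ofReal (abs_det_Hmat_le hK hK' hn y z)
      _ = ENNReal.ofReal (Real.exp (K * (n - 1 : ℕ))) *
            ((∫⁻ x, ENNReal.ofReal (Real.exp (K / k * x ^ 2)) ∂stdGauss) ^ k) ^ (n - 1) := by
          rw [lintegral_const_mul _ (by fun_prop), gaussMat]
          rw [lintegral_pi_prod (Measure.pi fun _ : Fin k => stdGauss)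
            (f := fun x => ∏ μ, ENNReal.ofReal (Real.exp (K / k * x μ ^ 2))) (by fun_prop),
            lintegral_pi_prod stdGauss
            (f := fun x => ENNReal.ofReal (Real.exp (K / k * x ^ 2))) (by fun_prop)]
      _ ≤ ENNReal.ofReal (Real.exp (K * (n - 1 : ℕ))) *
            (ENNReal.ofReal (Real.exp (C * (K / k))) ^ k) ^ (n - 1) := by
          gcongr
          exact hC _ (by positivity) hs
      _ = ENNReal.ofReal (Real.exp ((n - 1 : ℕ) * (K + C * K))) := by
          rw [← ENNReal.ofReal_pow (by positivity), ← ENNReal.ofReal_pow (by positivity),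
            ← ENNReal.ofReal_mul (by positivity), ← Real.exp_nat_mul, ← Real.exp_nat_mul,
            ← Real.exp_add]
          congr 2
          field_simp
      _ ≤ ENNReal.ofReal (Real.exp (n * (K + C * K))) := by
          gcongr
          omega
  exact (ENNReal.ofReal_le_ofReal_iff (by positivity)).1 hle

theorem mean_log_sq_le_log_mean_sq {k : ℕ} (hk : 0 < k) {a : Fin k → ℝ} (ha : ∀ i, a i ≠ 0) :
    (1 / (k : ℝ)) * ∑ i, 2 * Real.log |a i| ≤ Real.log ((1 / (k : ℝ)) * ∑ i, a i ^ 2) := by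
  have hk' : (0 : ℝ) < k := by exact_mod_cast hk
  have h := strictConcaveOn_log_Ioi.concaveOn.le_map_sum (t := Finset.univ)
    (w := fun _ : Fin k => 1 / (k : ℝ)) (p := fun i => a i ^ 2) (fun _ _ => by positivity)
    (by simp; field_simp) (fun i _ => by have := ha i; simp only [mem_Ioi]; positivity)
  simp only [smul_eq_mul, ← Finset.mul_sum] at h
  have e : ∀ i, Real.log (a i ^ 2) = 2 * Real.log |a i| := fun i => by
    rw [Real.log_abs, Real.log_pow, Nat.cast_ofNat]
  simpa only [e] using h

theorem exp_neg_half_log_mean_sq_le {k : ℕ} (hk : 0 < k) {a : Fin k → ℝ} (ha : ∀ i, a i ≠ 0)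
    {p θ : ℝ} (hp : 0 ≤ p) (hpθ : p ≤ θ * k) :
    ENNReal.ofReal (Real.exp (p * (-(1 / 2 : ℝ) * Real.log ((1 / (k : ℝ)) * ∑ i, a i ^ 2)))) ≤
      ∏ i, (1 + ENNReal.ofReal (|a i| ^ (-θ))) := by
  have hk' : (0 : ℝ) < k := by exact_mod_cast hk
  have h1 : p * (-(1 / 2 : ℝ) * Real.log ((1 / (k : ℝ)) * ∑ i, a i ^ 2)) ≤
      ∑ i, -(p / k) * Real.log |a i| := by
    have h := mul_le_mul_of_nonneg_left (mean_log_sq_le_log_mean_sq hk ha) hp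
    rw [← Finset.mul_sum] at h ⊢
    have e : p * (1 / (k : ℝ) * (2 * ∑ i, Real.log |a i|)) =
      2 * (p / k * ∑ i, Real.log |a i|) := by ring
    rw [e] at h
    linarith
  have hpk : p / k ≤ θ := by rwa [div_le_iff₀ hk']
  refine (ENNReal.ofReal_le_ofReal (Real.exp_le_exp.2 h1)).trans ?_
  rw [Real.exp_sum, ENNReal.ofReal_prod_of_nonneg fun i _ => by positivity]
  refine Finset.prod_le_prod' fun i _ => ?_
  have hai : 0 < |a i| := abs_pos.2 (ha i)
  rw [← ENNReal.ofReal_one, ← ENNReal.ofReal_add zero_le_one (by positivity)]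
  refine ENNReal.ofReal_le_ofReal ?_
  rw [mul_comm, ← Real.rpow_def_of_pos hai]
  have h0 : 0 ≤ |a i| ^ (-θ) := by positivity
  rcases le_total 1 |a i| with h | h
  · have := Real.rpow_le_one_of_one_le_of_nonpos h (neg_nonpos.2 (by positivity : 0 ≤ p / k))
    linarith
  · have := Real.rpow_le_rpow_of_exponent_ge hai h (neg_le_neg hpk)
    linarith

theorem exists_lintegral_exp_le {g : ℝ → ℝ} (hg : Measurable g)
    (hdens : ∃ ε > (0 : ℝ), ∃ f : ℝ → ℝ, ContinuousOn f (Ioo (-ε) ε) ∧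
      ∀ s ⊆ Ioo (-ε) ε, MeasurableSet s →
        Measure.map g stdGauss s = ∫⁻ a in s, ENNReal.ofReal (f a))
    {α : ℝ} {m : ℕ → ℕ} (hm : Tendsto (fun n => (m n : ℝ) / n) atTop (𝓝 α))
    {γ : ℝ} (hγ : γ ∈ Ioo 1 α) {G : (n : ℕ) → (Fin (m n) → ℝ) → ℝ} {B : ℝ}
    (hG : ∀ᶠ n in atTop, ∀ y, G n y ≤ B) :
    ∃ M : ℝ, ∀ᶠ n : ℕ in atTop,
      (∫⁻ y, ENNReal.ofReal (Real.exp (γ * n *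
          (-(1 / 2 : ℝ) * Real.log ((1 / (m n : ℝ)) * ∑ μ, (g (y μ)) ^ 2) + G n y)))
          ∂(gaussVec (m n)))
        ≤ ENNReal.ofReal (Real.exp ((n : ℝ) * M)) := by
  obtain ⟨hγ1, hγα⟩ := hγ
  obtain ⟨β, hβγ, hβα⟩ := exists_between hγα
  have hβ0 : 0 < β := by linarith
  set θ := γ / β with hθ
  have hθ0 : 0 < θ := by positivity
  have hθ1 : θ < 1 := (div_lt_one hβ0).2 hβγ
  set J := ∫⁻ y, (1 + ENNReal.ofReal (|g y| ^ (-θ))) ∂stdGauss with hJ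
  have hmeas : Measurable fun y => 1 + ENNReal.ofReal (|g y| ^ (-θ)) := by fun_prop
  have hJfin : J ≠ ⊤ := by
    rw [hJ, lintegral_add_left measurable_const]
    have := lintegral_abs_rpow_lt_top hg hdens (r := -θ) (by linarith) (by linarith)
    simpa using this.ne
  have hJ1 : 1 ≤ J := by
    rw [hJ, lintegral_add_left measurable_const]
    simp
  have hJr : 1 ≤ J.toReal := by
    simpa using ENNReal.toReal_mono hJfin hJ1
  refine ⟨γ * B + (α + 1) * Real.log J.toReal, ?_⟩
  filter_upwards [hG, eventually_gt_atTop 0, hm.eventually (lt_mem_nhds hβα),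
    hm.eventually (gt_mem_nhds (lt_add_one α))] with n hGn hn hnβ hnα
  have hn' : (0 : ℝ) < n := by exact_mod_cast hn
  rw [lt_div_iff₀ hn'] at hnβ
  rw [div_lt_iff₀ hn'] at hnα
  have hmn' : (0 : ℝ) < m n := lt_trans (by positivity) hnβ
  have hmn : 0 < m n := by exact_mod_cast hmn'
  have hae : ∀ᵐ y ∂(gaussVec (m n)), ∀ i, g (y i) ≠ 0 := by
    refine ae_all_iff.2 fun i => ?_
    exact (measurePreserving_eval (fun _ : Fin (m n) => stdGauss) i).quasiMeasurePreserving.ae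
      (ae_ne_zero_of_density hg hdens)
  calc _ ≤ ∫⁻ y, ENNReal.ofReal (Real.exp (γ * n * B)) *
          ∏ i, (1 + ENNReal.ofReal (|g (y i)| ^ (-θ))) ∂(gaussVec (m n)) := by
        refine lintegral_mono_ae (hae.mono fun y hy => ?_)
        have hθk : γ * n ≤ θ * m n := by
          rw [hθ, div_mul_eq_mul_div, le_div_iff₀ hβ0]
          nlinarith
        rw [mul_add, add_comm, Real.exp_add, ENNReal.ofReal_mul (by positivity)]
        refine mul_le_mul' (ENNReal.ofReal_le_ofReal (Real.exp_le_exp.2 ?_))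
          (exp_neg_half_log_mean_sq_le hmn hy (by positivity) hθk)
        exact mul_le_mul_of_nonneg_left (hGn y) (by positivity)
    _ = ENNReal.ofReal (Real.exp (γ * n * B)) * J ^ m n := by
        rw [lintegral_const_mul _ (by fun_prop), gaussVec, lintegral_pi_prod stdGauss hmeas]
    _ = ENNReal.ofReal (Real.exp (γ * n * B + m n * Real.log J.toReal)) := by
        rw [Real.exp_add, Real.exp_nat_mul, Real.exp_log (by linarith),
          ENNReal.ofReal_mul (by positivity), ENNReal.ofReal_pow (by positivity),
          ENNReal.ofReal_toReal hJfin]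
    _ ≤ _ := by
        refine ENNReal.ofReal_le_ofReal (Real.exp_le_exp.2 ?_)
        have := mul_le_mul_of_nonneg_right hnα.le (Real.log_nonneg hJr)
        linarith

theorem isProbabilityMeasure_empMeas {k : ℕ} (hk : 0 < k) (y : Fin k → ℝ) :
    IsProbabilityMeasure (empMeas y) := by
  refine ⟨?_⟩
  simp only [empMeas, Measure.smul_apply, Measure.finsetSum_apply, measure_univ, smul_eq_mul]
  simpa using ENNReal.inv_mul_cancel (by exact_mod_cast hk.ne') (ENNReal.natCast_ne_top k)

theorem moment_condition_varadhan
    (φ : ℝ → ℝ) (hφ : ContDiff ℝ 3 φ)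
    (hdens : ∃ ε > (0 : ℝ), ∃ f : ℝ → ℝ, ContinuousOn f (Ioo (-ε) ε) ∧
      ∀ s ⊆ Ioo (-ε) ε, MeasurableSet s →
        Measure.map (fun y => deriv φ y) stdGauss s = ∫⁻ a in s, ENNReal.ofReal (f a))
    (hbd : ∃ K : ℝ, ∀ x : ℝ, |x * deriv φ x| ≤ K ∧ |deriv (deriv φ) x| ≤ K ∧
      |deriv φ x| ≤ K)
    (α : ℝ) (hα : 1 < α)
    (m : ℕ → ℕ) (hm : Tendsto (fun n => (m n : ℝ) / n) atTop (𝓝 α))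
    (μAF : Measure ℝ → Measure ℝ) (hμAF : IsAsymptoticSpectralMeasure φ α μAF)
    (γ : ℝ) (hγ : γ ∈ Ioo 1 α) :
    (∃ M : ℝ, ∀ᶠ n : ℕ in atTop,
      (∫⁻ y, ENNReal.ofReal (Real.exp (γ * n *
          (-(1 / 2 : ℝ) * Real.log ((1 / (m n : ℝ)) * ∑ μ, (deriv φ (y μ)) ^ 2) +
            kappa μAF (empMeas y) (tphi φ (empMeas y))))) ∂(gaussVec (m n)))
        ≤ ENNReal.ofReal (Real.exp ((n : ℝ) * M)))
    ∧
    (∃ M : ℝ, ∀ᶠ n : ℕ in atTop,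
      (∫⁻ y, ENNReal.ofReal (Real.exp (γ * n *
          (-(1 / 2 : ℝ) * Real.log ((1 / (m n : ℝ)) * ∑ μ, (deriv φ (y μ)) ^ 2) +
            (1 / (n : ℝ)) * Real.log (Edet φ n (m n) y)))) ∂(gaussVec (m n)))
        ≤ ENNReal.ofReal (Real.exp ((n : ℝ) * M))) := by
  obtain ⟨K, hK⟩ := hbd
  have hg : Measurable (deriv φ) := measurable_deriv φ
  have hK2 : ∀ x, |deriv (deriv φ) x| ≤ K := fun x => (hK x).2.1
  have hK1 : ∀ x, |x * deriv φ x| ≤ K := fun x => (hK x).1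
  have hmtop : Tendsto m atTop atTop := by
    have h : Tendsto (fun n => (m n : ℝ) / n * n) atTop atTop :=
      hm.pos_mul_atTop (by linarith) tendsto_natCast_atTop_atTop
    refine tendsto_natCast_atTop_iff.1 (h.congr' ?_)
    filter_upwards [eventually_gt_atTop 0] with n hn
    field_simp
  refine ⟨exists_lintegral_exp_le (B := 32 * K ^ 2 + K ^ 2) hg hdens hm hγ
    (G := fun n y => kappa μAF (empMeas y) (tphi φ (empMeas y))) ?_, ?_⟩
  · filter_upwards [hmtop.eventually_gt_atTop 0] with n hn y
    have := isProbabilityMeasure_empMeas hn y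
    refine (kappa_le hα hK2 hμAF (empMeas y) _).trans ?_
    have ht : |tphi φ (empMeas y)| ≤ K := by
      simpa [tphi] using norm_integral_le_of_norm_le_const (μ := empMeas y)
        (f := fun x => x * deriv φ x) (ae_of_all _ hK1)
    linarith [sq_le_sq' (abs_le.1 ht).1 (abs_le.1 ht).2]
  · obtain ⟨B, hB0, hB⟩ := exists_Edet_le hK2 hK1
    refine exists_lintegral_exp_le (B := B) hg hdens hm hγ
      (G := fun n y => (1 / (n : ℝ)) * Real.log (Edet φ n (m n) y)) ?_
    filter_upwards [eventually_gt_atTop 0, hmtop.eventually_gt_atTop 0,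
      hmtop.eventually_ge_atTop ⌈4 * K⌉₊] with n hn hmn hmK y
    have hn' : (0 : ℝ) < n := by exact_mod_cast hn
    have hE := hB n (m n) hn hmn (Nat.ceil_le.1 hmK) y
    have hE0 : 0 ≤ Edet φ n (m n) y := integral_nonneg fun z => abs_nonneg _
    rw [one_div, inv_mul_le_iff₀ hn']
    rcases hE0.eq_or_lt with h0 | h0
    · rw [← h0, Real.log_zero]
      positivity
    · exact (Real.log_le_iff_le_exp h0).2 hE
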